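/- Let n ≥ 3 be even. Then max_{2 ≤ d ≤ n−1} J_min(D_{n,d}) = J_min(P_n) = (n³ − 3n² + 5n − 3)/3; that is, for every 2 ≤ d ≤ n−1 one has J_min(D_{n,d}) ≤ J_min(P_n), and P_n = D_{n,n−1} attains this value. -/

import Mathlib

open Finset
open scoped Classical

/-- The degree of vertex `v` in `G`. -/
noncomputable def gdeg {V : Type*} [Fintype V] (G : SimpleGraph V) (v : V) : ℕ :=
  (Finset.univ.filter fun u => G.Adj v u).card

/-- `ℓ(u,v;w) = (d(u,w) + d(v,w) - d(u,v))/2`. -/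
noncomputable def ell {V : Type*} (G : SimpleGraph V) (u v w : V) : ℚ :=
  ((G.dist u w : ℚ) + (G.dist v w : ℚ) - (G.dist u v : ℚ)) / 2

/-- The hitting time `H(u,w) = Σ_v ℓ(u,v;w)·deg(v)` (valid formula on trees). -/
noncomputable def hitTime {V : Type*} [Fintype V] (G : SimpleGraph V) (u w : V) : ℚ :=
  ∑ v, ell G u v w * (gdeg G v : ℚ)

/-- The joining time to `w`: `J(w) = Σ_u deg(u)·H(u,w)`. -/
noncomputable def joinTime {V : Type*} [Fintype V] (G : SimpleGraph V) (w : V) : ℚ :=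
  ∑ u, (gdeg G u : ℚ) * hitTime G u w

/-- `J_min(G) = min_{w} J(w)` (junk value 0 on the empty graph). -/
noncomputable def Jmin {V : Type*} [Fintype V] (G : SimpleGraph V) : ℚ :=
  if h : Nonempty V then
    haveI := h
    Finset.univ.inf' Finset.univ_nonempty (joinTime G)
  else 0

/-- The best meeting time `T_bestmeet(G) = J_min(G)/(2(n-1))`. -/
noncomputable def bestMeet {V : Type*} [Fintype V] (G : SimpleGraph V) : ℚ :=
  Jmin G / (2 * ((Fintype.card V : ℚ) - 1))

/-- The diameter of `G` : the maximum of `d(u,v)` over pairs of vertices. -/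
noncomputable def gdiam {V : Type*} [Fintype V] (G : SimpleGraph V) : ℕ :=
  Finset.univ.sup fun p : V × V => G.dist p.1 p.2

/-- The lever of order `n` and diameter `d` with fulcrum `v_k`: a path `v_0, …, v_d`
(on vertices `0, …, d`) together with `n - d - 1` pendant leaves (vertices `d+1, …, n-1`)
all adjacent to `v_k`. -/
def leverGraph (n d k : ℕ) : SimpleGraph (Fin n) :=
  SimpleGraph.fromRel fun i j =>
    (i.val + 1 = j.val ∧ j.val ≤ d) ∨ (i.val = k ∧ d < j.val)

/-- The balanced lever `L_{n,d}`: the lever with fulcrum `v_{⌊d/2⌋}`. -/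
def balancedLever (n d : ℕ) : SimpleGraph (Fin n) :=
  leverGraph n d (d / 2)

/-- The double broom of order `n`, diameter `d`, with `a` extra pendant leaves adjacent
to `v_1` and `n - d - 1 - a` extra pendant leaves adjacent to `v_{d-1}`.  The path
`v_0, …, v_d` sits on vertices `0, …, d`, the leaves at `v_1` are `d+1, …, d+a`, and the
leaves at `v_{d-1}` are `d+a+1, …, n-1`. -/
def doubleBroom (n d a : ℕ) : SimpleGraph (Fin n) :=
  SimpleGraph.fromRel fun i j =>
    (i.val + 1 = j.val ∧ j.val ≤ d) ∨
    (i.val = 1 ∧ d < j.val ∧ j.val ≤ d + a) ∨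
    (i.val = d - 1 ∧ d + a < j.val)

/-- The balanced double broom `D_{n,d}`, with `⌊(n-d-1)/2⌋` leaves at `v_1`
and `⌈(n-d-1)/2⌉` leaves at `v_{d-1}`. -/
def balancedDoubleBroom (n d : ℕ) : SimpleGraph (Fin n) :=
  doubleBroom n d ((n - d - 1) / 2)

/-- The broom `B_{n,d}`: a path `v_0, …, v_d` with `n - d - 1` pendant leaves adjacent to `v_1`. -/
def broomGraph (n d : ℕ) : SimpleGraph (Fin n) :=
  doubleBroom n d (n - d - 1)

/-- The star `S_n = K_{1,n-1}` with center `0`. -/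
def starGraph (n : ℕ) : SimpleGraph (Fin n) :=
  SimpleGraph.fromRel fun i _ => i.val = 0

/-- The vertices of `G` other than the root `w` have parents given by `p`, the edges of `G` are
exactly the edges from a vertex to its parent, and `A v` is the set of non-root vertices on the
path from `v` to `w`. -/
structure IsRootedTree {V : Type*} (G : SimpleGraph V) (w : V) (p : V → V)
    (A : V → Finset V) : Prop where
  root : A w = ∅
  notMem_parent : ∀ v, v ≠ w → v ∉ A (p v)
  mem_iff : ∀ v, v ≠ w → ∀ x, x ∈ A v ↔ x = v ∨ x ∈ A (p v)
  adj_iff : ∀ u v, G.Adj u v ↔ (u ≠ w ∧ p u = v) ∨ (v ≠ w ∧ p v = u)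

namespace IsRootedTree

variable {V : Type*} {G : SimpleGraph V} {w : V} {p : V → V}
  {A : V → Finset V}

theorem self_mem (h : IsRootedTree G w p A) {v : V} (hv : v ≠ w) : v ∈ A v :=
  (h.mem_iff v hv v).2 (Or.inl rfl)

theorem ne_root_of_mem (h : IsRootedTree G w p A) {x v : V} (hx : x ∈ A v) : v ≠ w := by
  rintro rfl
  simp [h.root] at hx

variable [DecidableEq V]

theorem eq_insert (h : IsRootedTree G w p A) {v : V} (hv : v ≠ w) :
    A v = insert v (A (p v)) := by
  ext x
  simp [h.mem_iff v hv x]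

theorem card_parent (h : IsRootedTree G w p A) {v : V} (hv : v ≠ w) :
    (A v).card = (A (p v)).card + 1 := by
  rw [h.eq_insert hv, card_insert_of_notMem (h.notMem_parent v hv)]

theorem subset_of_mem (h : IsRootedTree G w p A) {x u : V} (hx : x ∈ A u) : A x ⊆ A u := by
  induction hN : (A u).card generalizing u with
  | zero => simp_all
  | succ N ih =>
    have hu := h.ne_root_of_mem hx
    rcases (h.mem_iff u hu x).1 hx with rfl | hx'
    · exact Subset.refl _
    · have := h.card_parent hu
      refine (ih hx' (by omega)).trans ?_
      rw [h.eq_insert hu]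
      exact subset_insert _ _

theorem ne_root_of_mem_left (h : IsRootedTree G w p A) {x v : V} (hx : x ∈ A v) : x ≠ w := by
  rintro rfl
  induction hN : (A v).card generalizing v with
  | zero => simp_all
  | succ N ih =>
    have hv := h.ne_root_of_mem hx
    have := h.card_parent hv
    exact ih (((h.mem_iff v hv x).1 hx).resolve_left hv.symm) (by omega)

theorem injective (h : IsRootedTree G w p A) : Function.Injective A := by
  intro u v huv
  by_cases hu : u = w
  · by_contra hne
    have hv : v ≠ w := fun e => hne (hu.trans e.symm)
    have := h.self_mem hv
    rw [← huv, hu, h.root] at this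
    simp at this
  · have hmem : u ∈ A v := huv ▸ h.self_mem hu
    have hv := h.ne_root_of_mem hmem
    rcases (h.mem_iff v hv u).1 hmem with e | hm
    · exact e
    · exact absurd (h.subset_of_mem hm (huv ▸ h.self_mem hv)) (h.notMem_parent v hv)

theorem card_symmDiff_le_length (h : IsRootedTree G w p A) {u v : V} (q : G.Walk u v) :
    (symmDiff (A u) (A v)).card ≤ q.length := by
  have parent : ∀ v, v ≠ w → symmDiff (A v) (A (p v)) ⊆ {v} := by
    intro v hv x hx
    rw [mem_symmDiff, h.mem_iff v hv] at hx
    simp only [mem_singleton]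
    tauto
  induction q with
  | nil => simp
  | @cons a b c hab q ih =>
    have hstep : (symmDiff (A a) (A b)).card ≤ 1 := by
      rcases (h.adj_iff a b).1 hab with ⟨hne, rfl⟩ | ⟨hne, rfl⟩
      · exact card_le_card (parent a hne)
      · rw [symmDiff_comm]
        exact card_le_card (parent b hne)
    have htri := card_le_card (show symmDiff (A a) (A c) ⊆ symmDiff (A a) (A b) ∪
      symmDiff (A b) (A c) from symmDiff_triangle _ _ _)
    have := card_union_le (symmDiff (A a) (A b)) (symmDiff (A b) (A c))
    rw [SimpleGraph.Walk.length_cons]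
    omega

theorem card_symmDiff_parent (h : IsRootedTree G w p A) {x u v : V} (hxu : x ∈ A u)
    (hxv : x ∉ A v) :
    (symmDiff (A u) (A v)).card = (symmDiff (A (p u)) (A v)).card + 1 := by
  have hu := h.ne_root_of_mem hxu
  have huv : u ∉ A v := fun hm => hxv (h.subset_of_mem hm hxu)
  have hup := h.notMem_parent u hu
  rw [← card_insert_of_notMem (a := u) (by simp [mem_symmDiff, huv, hup])]
  congr 1
  ext y
  simp only [mem_symmDiff, h.mem_iff u hu, mem_insert]
  by_cases hy : y = u
  · subst hy; tauto
  · tauto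

theorem exists_walk (h : IsRootedTree G w p A) (u v : V) :
    ∃ q : G.Walk u v, q.length = (symmDiff (A u) (A v)).card := by
  induction hN : (symmDiff (A u) (A v)).card generalizing u v with
  | zero =>
    have huv : A u = A v := by
      rwa [card_eq_zero, ← bot_eq_empty, symmDiff_eq_bot] at hN
    obtain rfl := h.injective huv
    exact ⟨.nil, rfl⟩
  | succ N ih =>
    have step : ∀ a b x, (symmDiff (A a) (A b)).card = N + 1 → x ∈ A a → x ∉ A b →
        ∃ q : G.Walk a b, q.length = N + 1 := by
      intro a b x hab ha hb
      have := h.card_symmDiff_parent ha hb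
      obtain ⟨q, hq⟩ := ih (p a) b (by omega)
      have hadj : G.Adj a (p a) := (h.adj_iff _ _).2 (Or.inl ⟨h.ne_root_of_mem ha, rfl⟩)
      exact ⟨.cons hadj q, by simp [hq]⟩
    obtain ⟨x, hx⟩ : (symmDiff (A u) (A v)).Nonempty := card_pos.1 (by omega)
    rcases mem_symmDiff.1 hx with ⟨h1, h2⟩ | ⟨h1, h2⟩
    · exact step u v x hN h1 h2
    · obtain ⟨q, hq⟩ := step v u x (by rwa [symmDiff_comm]) h1 h2
      exact ⟨q.reverse, by simp [hq]⟩

theorem dist_eq (h : IsRootedTree G w p A) (u v : V) :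
    G.dist u v = (symmDiff (A u) (A v)).card := by
  obtain ⟨q, hq⟩ := h.exists_walk u v
  obtain ⟨r, hr⟩ := q.reachable.exists_walk_length_eq_dist
  refine le_antisymm (hq ▸ SimpleGraph.dist_le q) (hr ▸ h.card_symmDiff_le_length r)

theorem ell_eq (h : IsRootedTree G w p A) (u v : V) :
    ell G u v w = ((A u ∩ A v).card : ℚ) := by
  have hsymm : (symmDiff (A u) (A v)).card + 2 * (A u ∩ A v).card = (A u).card + (A v).card := by
    have h1 := card_sdiff_add_card_inter (A u) (A v)
    have h2 := card_sdiff_add_card_inter (A v) (A u)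
    have h3 : (symmDiff (A u) (A v)).card = (A u \ A v).card + (A v \ A u).card :=
      card_union_of_disjoint disjoint_sdiff_sdiff
    rw [inter_comm] at h2
    omega
  have hq : ((symmDiff (A u) (A v)).card : ℚ) + 2 * (A u ∩ A v).card =
      (A u).card + (A v).card := by exact_mod_cast hsymm
  have hroot : ∀ v, G.dist v w = (A v).card := fun v => by
    rw [h.dist_eq, h.root, ← bot_eq_empty, symmDiff_bot]
  rw [ell, hroot, hroot, h.dist_eq]
  linarith

variable [Fintype V]

theorem sum_gdeg (h : IsRootedTree G w p A) {x : V} (hx : x ≠ w) :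
    ∑ u with x ∈ A u, (gdeg G u : ℚ) = 2 * (#{u | x ∈ A u} : ℚ) - 1 := by
  have hdeg : ∀ u, (gdeg G u : ℚ) = (if u ≠ w then 1 else 0) +
      ∑ y, if y ≠ w ∧ p y = u then (1 : ℚ) else 0 := by
    intro u
    have hpar : (if u ≠ w then (1 : ℚ) else 0) =
        ∑ y, if u ≠ w ∧ p u = y then (1 : ℚ) else 0 := by
      by_cases hu : u = w <;> simp [hu]
    rw [hpar, ← sum_add_distrib, gdeg, card_filter, Nat.cast_sum]
    refine sum_congr rfl fun y _ => ?_
    have hexcl : ¬((u ≠ w ∧ p u = y) ∧ (y ≠ w ∧ p y = u)) := by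
      rintro ⟨⟨hu, rfl⟩, hy, hpu⟩
      have h1 := h.card_parent hu
      have h2 := h.card_parent hy
      rw [hpu] at h2
      omega
    by_cases h1 : u ≠ w ∧ p u = y <;> by_cases h2 : y ≠ w ∧ p y = u
    · exact absurd ⟨h1, h2⟩ hexcl
    all_goals rw [if_congr (h.adj_iff u y) rfl rfl]; simp only [h1, h2]; simp
  have hself : x ∈ ({u | x ∈ A u} : Finset V) := by simp [h.self_mem hx]
  have hchild : ∑ u with x ∈ A u, (∑ y, if y ≠ w ∧ p y = u then (1 : ℚ) else 0) =
      (#(({u | x ∈ A u} : Finset V).erase x) : ℚ) := by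
    rw [sum_comm, card_eq_sum_ones, Nat.cast_sum, ← sum_filter_add_sum_filter_not univ
      (fun y => y ∈ ({u | x ∈ A u} : Finset V).erase x)]
    rw [filter_mem_eq_inter, univ_inter, sum_eq_zero (s := filter _ _), add_zero]
    · refine sum_congr rfl fun y hy => ?_
      simp only [mem_erase, mem_filter, mem_univ, true_and] at hy
      have hyw := h.ne_root_of_mem hy.2
      have hm := ((h.mem_iff y hyw x).1 hy.2).resolve_left hy.1.symm
      simp [hyw, hm]
    · intro y hy
      simp only [mem_erase, mem_filter, mem_univ, true_and, not_and] at hy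
      refine sum_eq_zero fun u hu => if_neg ?_
      rintro ⟨hyw, rfl⟩
      have hm := (mem_filter.1 hu).2
      refine hy ?_ ((h.mem_iff y hyw x).2 (Or.inr hm))
      rintro rfl
      exact h.notMem_parent y hyw hm
  rw [sum_congr rfl fun u _ => hdeg u, sum_add_distrib, hchild, cast_card_erase_of_mem hself]
  rw [sum_congr rfl fun u hu => if_pos (h.ne_root_of_mem (mem_filter.1 hu).2)]
  simp only [sum_const, nsmul_eq_mul, mul_one]
  ring

/-- The joining time to the root is the sum over the edges of the squared volume of the
component that does not contain the root. -/
theorem joinTime_eq (h : IsRootedTree G w p A) :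
    joinTime G w = ∑ x, if x = w then (0 : ℚ) else (2 * (#{u | x ∈ A u} : ℚ) - 1) ^ 2 := by
  have hell : ∀ u v, ell G u v w =
      ∑ x, (if x ∈ A u then (1 : ℚ) else 0) * (if x ∈ A v then 1 else 0) := by
    intro u v
    rw [h.ell_eq, card_eq_sum_ones, Nat.cast_sum, ← sum_filter_add_sum_filter_not univ
      (fun x => x ∈ A u ∩ A v), filter_mem_eq_inter, univ_inter, sum_eq_zero (s := filter _ _),
      add_zero]
    · refine sum_congr rfl fun x hx => ?_
      simp [(mem_inter.1 hx).1, (mem_inter.1 hx).2]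
    · intro x hx
      simp only [mem_inter, mem_filter, mem_univ, true_and, not_and] at hx
      by_cases hu : x ∈ A u
      · simp [hx hu]
      · simp [hu]
  have hsq : joinTime G w = ∑ x, (∑ u with x ∈ A u, (gdeg G u : ℚ)) ^ 2 := by
    have hsum : ∀ x, (∑ u with x ∈ A u, (gdeg G u : ℚ)) ^ 2 = ∑ u, ∑ v,
        (gdeg G u : ℚ) * ((if x ∈ A u then 1 else 0) * (if x ∈ A v then 1 else 0) *
          (gdeg G v : ℚ)) := by
      intro x
      rw [sq, sum_filter, sum_mul_sum]
      refine sum_congr rfl fun u _ => sum_congr rfl fun v _ => ?_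
      split_ifs <;> simp
    simp only [joinTime, hitTime, hell, hsum, sum_mul, mul_sum]
    rw [sum_comm]
    conv_rhs => rw [sum_comm]
    rw [sum_comm]
    refine sum_congr rfl fun u _ => ?_
    conv_rhs => rw [sum_comm]
  rw [hsq]
  refine sum_congr rfl fun x _ => ?_
  split_ifs with hx
  · rw [filter_false_of_mem fun u _ hu => h.ne_root_of_mem_left hu hx]
    simp
  · rw [h.sum_gdeg hx]

end IsRootedTree

/-- The joining time to the vertex at position `k` of a path on `n` vertices. -/
def pathJoin (n k : ℕ) : ℚ :=
  ∑ j : Fin n, if (j : ℕ) = k then (0 : ℚ)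
    else (2 * ((if (j : ℕ) < k then (j : ℕ) + 1 else n - j : ℕ) : ℚ) - 1) ^ 2

theorem sum_odd_sq (r : ℕ) :
    ∑ i ∈ range r, (2 * ((i + 1 : ℕ) : ℚ) - 1) ^ 2 = r * (4 * (r : ℚ) ^ 2 - 1) / 3 := by
  induction r with
  | zero => simp
  | succ r ih => rw [sum_range_succ, ih]; push_cast; ring

theorem pathJoin_eq (k r : ℕ) :
    pathJoin (k + 1 + r) k =
      k * (4 * (k : ℚ) ^ 2 - 1) / 3 + r * (4 * (r : ℚ) ^ 2 - 1) / 3 := by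
  rw [pathJoin, Fin.sum_univ_eq_sum_range (fun j => if j = k then (0 : ℚ)
    else (2 * ((if j < k then j + 1 else k + 1 + r - j : ℕ) : ℚ) - 1) ^ 2), sum_range_add,
    sum_range_succ, if_pos rfl, add_zero, ← sum_odd_sq k, ← sum_odd_sq r,
    ← sum_range_reflect _ r]
  congr 1
  · refine sum_congr rfl fun j hj => ?_
    have := mem_range.1 hj
    rw [if_neg (by omega), if_pos this]
  · refine sum_congr rfl fun j hj => ?_
    have := mem_range.1 hj
    rw [if_neg (by omega), if_neg (by omega), show k + 1 + r - (k + 1 + (r - 1 - j)) = j + 1 by omega]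

theorem pathJoin_center {m : ℕ} (hm : 1 ≤ m) :
    pathJoin (2 * m) (m - 1) =
      (((2 * m : ℕ) : ℚ) ^ 3 - 3 * ((2 * m : ℕ) : ℚ) ^ 2 + 5 * ((2 * m : ℕ) : ℚ) - 3) / 3 := by
  obtain ⟨t, rfl⟩ := Nat.exists_eq_add_of_le' hm
  rw [Nat.add_sub_cancel, show 2 * (t + 1) = t + 1 + (t + 1) by ring, pathJoin_eq]
  push_cast
  ring

theorem pathJoin_center_le {m k : ℕ} (hk : k < 2 * m) :
    pathJoin (2 * m) (m - 1) ≤ pathJoin (2 * m) k := by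
  rw [pathJoin_center (by omega)]
  obtain ⟨r, hr⟩ := Nat.exists_eq_add_of_lt hk
  have hr' : 2 * m = k + 1 + r := by omega
  have hq : 2 * (m : ℚ) = k + 1 + r := by exact_mod_cast hr'
  have hint : (0 : ℚ) ≤ ((k : ℚ) - m) * (k - m + 1) := by
    have : (0 : ℤ) ≤ ((k : ℤ) - m) * (k - m + 1) := by
      rcases le_or_gt (m : ℤ) k with h | h <;> nlinarith
    exact_mod_cast this
  rw [hr', pathJoin_eq, ← hr']
  push_cast
  rw [show (r : ℚ) = 2 * m - 1 - k by linarith]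
  have hm0 : (0 : ℚ) ≤ 2 * m - 1 := by
    have : (1 : ℚ) ≤ m := by exact_mod_cast (by omega : 1 ≤ m)
    linarith
  nlinarith [mul_nonneg hm0 hint]

theorem IsRootedTree.joinTime_le_pathJoin {n : ℕ} {G : SimpleGraph (Fin n)} {w : Fin n}
    {p : Fin n → Fin n} {A : Fin n → Finset (Fin n)} (h : IsRootedTree G w p A)
    {σ : Fin n → Fin n} (hσ : Function.Injective σ)
    (hA : ∀ x u, x ∈ A u → σ x < σ w ∧ σ u ≤ σ x ∨ σ w < σ x ∧ σ x ≤ σ u) :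
    joinTime G w ≤ pathJoin n (σ w) := by
  rw [h.joinTime_eq, pathJoin,
    ← (Finite.injective_iff_bijective.1 hσ).sum_comp (fun j : Fin n => if (j : ℕ) = σ w then _ else _)]
  refine sum_le_sum fun x _ => ?_
  by_cases hx : x = w
  · simp [hx]
  have hne : (σ x : ℕ) ≠ σ w := fun e => hx (hσ (Fin.ext e))
  rw [if_neg hx, if_neg hne]
  have hpos : 1 ≤ #{u | x ∈ A u} := card_pos.2 ⟨x, by simp [h.self_mem hx]⟩
  have hle : #{u | x ∈ A u} ≤ if (σ x : ℕ) < σ w then (σ x : ℕ) + 1 else n - σ x := by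
    rw [← card_image_of_injective _ hσ]
    split_ifs with hlt
    · rw [← Fin.card_Iic]
      refine card_le_card fun y hy => ?_
      obtain ⟨u, hu, rfl⟩ := mem_image.1 hy
      have := hA x u (by simpa using hu)
      rw [mem_Iic]
      omega
    · rw [← Fin.card_Ici]
      refine card_le_card fun y hy => ?_
      obtain ⟨u, hu, rfl⟩ := mem_image.1 hy
      have := hA x u (by simpa using hu)
      rw [mem_Ici]
      omega
  have h1 : (1 : ℚ) ≤ #{u | x ∈ A u} := by exact_mod_cast hpos
  have h2 := (Nat.cast_le (α := ℚ)).2 hle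
  exact pow_le_pow_left₀ (by linarith) (by linarith) 2

theorem isRootedTree_pathGraph (n : ℕ) (k : Fin n) :
    IsRootedTree (SimpleGraph.pathGraph n) k
      (fun i => if h : i < k then ⟨i + 1, by omega⟩ else ⟨i - 1, by omega⟩)
      (fun i => {x | (i ≤ x ∧ x < k) ∨ (k < x ∧ x ≤ i)}) where
  root := by ext x; simp
  notMem_parent v hv := by
    simp only [mem_filter, mem_univ, true_and]
    split_ifs <;> simp only [Fin.lt_def, Fin.le_def] <;> omega
  mem_iff v hv x := by
    simp only [mem_filter, mem_univ, true_and]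
    split_ifs <;> simp only [Fin.lt_def, Fin.le_def] <;> omega
  adj_iff u v := by
    rw [SimpleGraph.pathGraph_adj]
    split_ifs <;> simp only [Fin.ext_iff] <;> omega

theorem joinTime_pathGraph (n : ℕ) (k : Fin n) :
    joinTime (SimpleGraph.pathGraph n) k = pathJoin n k := by
  rw [(isRootedTree_pathGraph n k).joinTime_eq, pathJoin]
  refine sum_congr rfl fun x _ => ?_
  by_cases hx : x = k
  · simp [hx]
  have hne : (x : ℕ) ≠ k := fun e => hx (Fin.ext e)
  rw [if_neg hx, if_neg hne]
  congr 4
  split_ifs with hlt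
  · rw [← Fin.card_Iic]
    congr 1
    ext u
    simp only [mem_filter, mem_univ, true_and, mem_Iic]
    omega
  · rw [← Fin.card_Ici]
    congr 1
    ext u
    simp only [mem_filter, mem_univ, true_and, mem_Ici]
    omega

/-- The position of vertex `i` of the double broom along its spine. -/
def broomPos (d a i : ℕ) : ℕ := if i ≤ d then i else if i ≤ d + a then 0 else d

/-- The neighbour of vertex `i` of the double broom towards vertex `k` of its spine. -/
def broomParent (d a k i : ℕ) : ℕ :=
  if d < i then (if i ≤ d + a then 1 else d - 1) else if i < k then i + 1 else i - 1

theorem isRootedTree_doubleBroom {n d a k : ℕ} (hd : d < n) (hk : 1 ≤ k) (hkd : k < d) :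
    IsRootedTree (doubleBroom n d a) ⟨k, hkd.trans hd⟩
      (fun i => ⟨broomParent d a k i, by rw [broomParent]; split_ifs <;> omega⟩)
      (fun i => univ.filter fun x => x.val ≠ k ∧ (x.val = i.val ∨ (1 ≤ x.val ∧ x.val < d ∧
        (broomPos d a i ≤ x.val ∧ x.val < k ∨ k < x.val ∧ x.val ≤ broomPos d a i)))) where
  root := by
    ext x
    simp only [mem_filter, mem_univ, true_and, broomPos, notMem_empty, iff_false]
    split_ifs <;> omega
  notMem_parent v hv := by
    simp only [mem_filter, mem_univ, true_and]
    simp only [broomPos, broomParent]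
    simp only [Fin.ext_iff, ne_eq] at hv
    split_ifs <;> omega
  mem_iff v hv x := by
    simp only [mem_filter, mem_univ, true_and]
    simp only [broomPos, broomParent]
    simp only [Fin.ext_iff, ne_eq] at hv ⊢
    split_ifs <;> omega
  adj_iff u v := by
    simp only [doubleBroom, SimpleGraph.fromRel_adj, Fin.ext_iff, ne_eq, broomParent]
    split_ifs <;> omega

/-- An enumeration of the vertices of the double broom from its left end to its right end. -/
def broomRank (d a i : ℕ) : ℕ :=
  if i = 0 then 0 else if i ≤ d then a + i else if i ≤ d + a then i - d else i

theorem broomRank_injective (d a : ℕ) : Function.Injective (broomRank d a) := by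
  intro i j hij
  simp only [broomRank] at hij
  split_ifs at hij <;> omega

theorem broomRank_lt {n d a i : ℕ} (hda : d + a < n) (hi : i < n) : broomRank d a i < n := by
  rw [broomRank]
  split_ifs <;> omega

theorem broomRank_spine {d a i : ℕ} (hi : 1 ≤ i) (hid : i ≤ d) : broomRank d a i = a + i := by
  rw [broomRank, if_neg (by omega), if_pos hid]

theorem broomRank_ne {d a k i : ℕ} (hk : 1 ≤ k) (hkd : k < d) (hik : i ≠ k) :
    broomRank d a i ≠ a + k := by
  rw [← broomRank_spine hk hkd.le]
  exact (broomRank_injective d a).ne hik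

theorem broomRank_le_of_broomPos_le {d a x i : ℕ} (hx : 1 ≤ x) (hxd : x < d)
    (h : broomPos d a i ≤ x) : broomRank d a i ≤ a + x := by
  rw [broomPos] at h
  rw [broomRank]
  split_ifs at h ⊢ <;> omega

theorem le_broomRank_of_le_broomPos {d a x i : ℕ} (hx : 1 ≤ x) (hxd : x < d)
    (h : x ≤ broomPos d a i) : a + x ≤ broomRank d a i := by
  rw [broomPos] at h
  rw [broomRank]
  split_ifs at h ⊢ <;> omega

theorem joinTime_doubleBroom_le {n d a k : ℕ} (hk : 1 ≤ k) (hkd : k < d) (hda : d + a < n) :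
    joinTime (doubleBroom n d a) ⟨k, by omega⟩ ≤ pathJoin n (a + k) := by
  have hd : d < n := by omega
  let σ : Fin n → Fin n := fun i => ⟨broomRank d a i, broomRank_lt hda i.2⟩
  have hσ : Function.Injective σ := fun i j hij =>
    Fin.ext (broomRank_injective d a (congrArg Fin.val hij))
  have hle := (isRootedTree_doubleBroom (a := a) hd hk hkd).joinTime_le_pathJoin hσ
    fun x u hx => ?_
  · rwa [show (σ ⟨k, hkd.trans hd⟩ : ℕ) = a + k from broomRank_spine hk hkd.le] at hle
  simp only [mem_filter, mem_univ, true_and] at hx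
  simp only [σ, Fin.lt_def, Fin.le_def, broomRank_spine hk hkd.le]
  obtain ⟨hxk, hxu | ⟨hx1, hxd, ⟨hpos, hlt⟩ | ⟨hlt, hpos⟩⟩⟩ := hx
  · have := broomRank_ne (a := a) hk hkd hxk
    rw [hxu] at this ⊢
    omega
  · have := broomRank_le_of_broomPos_le hx1 hxd hpos
    rw [broomRank_spine hx1 hxd.le]
    omega
  · have := le_broomRank_of_le_broomPos hx1 hxd hpos
    rw [broomRank_spine hx1 hxd.le]
    omega

theorem balancedDoubleBroom_eq_pathGraph (n : ℕ) :
    balancedDoubleBroom n (n - 1) = SimpleGraph.pathGraph n := by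
  ext u v
  rw [SimpleGraph.pathGraph_adj, balancedDoubleBroom, doubleBroom, SimpleGraph.fromRel_adj]
  simp only [ne_eq, Fin.ext_iff]
  omega

theorem Jmin_eq_inf' {n : ℕ} [NeZero n] (G : SimpleGraph (Fin n)) :
    Jmin G = univ.inf' univ_nonempty (joinTime G) :=
  dif_pos ⟨0⟩

/-- for even `n`, the path maximizes `J_min` among balanced double brooms. -/
theorem max_Jmin_balancedDoubleBroom_even (n : ℕ) (hn : 3 ≤ n) (he : Even n) :
    (∀ d : ℕ, 2 ≤ d → d ≤ n - 1 →
      Jmin (balancedDoubleBroom n d) ≤ Jmin (SimpleGraph.pathGraph n)) ∧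
    Jmin (SimpleGraph.pathGraph n) = ((n : ℚ)^3 - 3*(n : ℚ)^2 + 5*(n : ℚ) - 3)/3 ∧
    Jmin (balancedDoubleBroom n (n - 1)) = Jmin (SimpleGraph.pathGraph n) := by
  obtain ⟨m, rfl⟩ := he.two_dvd
  have : NeZero (2 * m) := ⟨by omega⟩
  have hpath : Jmin (SimpleGraph.pathGraph (2 * m)) = pathJoin (2 * m) (m - 1) := by
    rw [Jmin_eq_inf']
    refine le_antisymm ?_ (le_inf' _ _ fun k _ => ?_)
    · rw [← joinTime_pathGraph (2 * m) ⟨m - 1, by omega⟩]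
      exact inf'_le _ (mem_univ _)
    · rw [joinTime_pathGraph]
      exact pathJoin_center_le k.2
  refine ⟨fun d hd hdn => ?_, hpath.trans (pathJoin_center (by omega)),
    by rw [balancedDoubleBroom_eq_pathGraph]⟩
  have hle := joinTime_doubleBroom_le (n := 2 * m) (d := d) (a := (2 * m - d - 1) / 2)
    (k := d / 2) (by omega) (by omega) (by omega)
  rw [show (2 * m - d - 1) / 2 + d / 2 = m - 1 by omega] at hle
  rw [hpath, Jmin_eq_inf']
  exact (inf'_le _ (mem_univ _)).trans hle
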